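/- Let b ≥ 3 be an integer and let p_{n,k} be the number of f-legal k-element subsets of {0, 1, …, bn − 1}, where f(n) = max(1, n mod b). Then for every real y > 0 and every n ≥ 0, setting D = (b² − 4)y² + 2by + 1 (which is positive), one has ∑_{k ≥ 0} p_{n,k} y^k = [ (by + 1 + √D)^{n+1} − (by + 1 − √D)^{n+1} ] / ( 2^{n+1} √D ). -/

import Mathlib

open Finset

/-- A finite set of indices `S` is `f`-legal. -/
def FLegal (f : ℕ → ℕ) (S : Finset ℕ) : Prop :=
  ∀ i ∈ S, ∀ j ∈ S, j < i → f i < i - j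

instance (f : ℕ → ℕ) (S : Finset ℕ) : Decidable (FLegal f S) := by
  unfold FLegal; infer_instance

/-- `pCount b n k`: the number of `f`-legal `k`-element subsets of `{0, …, b*n − 1}`,
where `f m = max 1 (m % b)`. -/
def pCount (b n k : ℕ) : ℕ :=
  (((Finset.range (b * n)).powersetCard k).filter
    (fun S => FLegal (fun m => max 1 (m % b)) S)).card

/-- The generating polynomial, evaluated at `y`, of the `f`-legal subsets of `{0, …, m − 1}`
by cardinality. -/
noncomputable def legalSum (f : ℕ → ℕ) (y : ℝ) (m : ℕ) : ℝ :=
  ∑ S ∈ (range m).powerset, if FLegal f S then y ^ S.card else 0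

theorem FLegal.insert_iff {f : ℕ → ℕ} {m : ℕ} {S : Finset ℕ} (hS : S ⊆ range m) :
    FLegal f (insert m S) ↔ FLegal f S ∧ S ⊆ range (m - f m) := by
  have hlt : ∀ i ∈ S, i < m := fun i hi => mem_range.1 (hS hi)
  constructor
  · intro h
    refine ⟨fun i hi j hj => h i (mem_insert_of_mem hi) j (mem_insert_of_mem hj), fun j hj => ?_⟩
    have := h m (mem_insert_self _ _) j (mem_insert_of_mem hj) (hlt j hj)
    rw [mem_range]
    omega
  · rintro ⟨h, hsub⟩ i hi j hj hji
    rcases mem_insert.1 hi with rfl | hiS <;> rcases mem_insert.1 hj with rfl | hjS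
    · omega
    · have := mem_range.1 (hsub hjS)
      omega
    · have := hlt i hiS
      omega
    · exact h i hiS j hjS hji

theorem legalSum_zero (f : ℕ → ℕ) (y : ℝ) : legalSum f y 0 = 1 := by
  simp [legalSum, FLegal]

theorem legalSum_succ (f : ℕ → ℕ) (y : ℝ) (m : ℕ) :
    legalSum f y (m + 1) = legalSum f y m + y * legalSum f y (m - f m) := by
  unfold legalSum
  rw [range_add_one, sum_powerset_insert notMem_range_self, mul_sum]
  congr 1
  symm
  have hsub : (range (m - f m)).powerset ⊆ (range m).powerset :=
    powerset_mono.2 (range_mono (Nat.sub_le _ _))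
  have hcard : ∀ S ∈ (range m).powerset, (insert m S).card = S.card + 1 := fun S hS =>
    card_insert_of_notMem fun h => notMem_range_self (mem_powerset.1 hS h)
  rw [← sum_subset hsub]
  · refine sum_congr rfl fun S hS => ?_
    have hm := hsub hS
    rw [hcard S hm]
    simp only [FLegal.insert_iff (mem_powerset.1 hm), mem_powerset.1 hS, and_true]
    split_ifs
    · ring
    · simp
  · intro S hm hS
    rw [if_neg]
    rw [FLegal.insert_iff (mem_powerset.1 hm)]
    exact fun h => hS (mem_powerset.2 h.2)

theorem sum_pCount_mul_pow (b n : ℕ) (y : ℝ) :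
    ∑ k ∈ range (b * n + 1), (pCount b n k : ℝ) * y ^ k =
      legalSum (fun m => max 1 (m % b)) y (b * n) := by
  rw [legalSum, sum_powerset, card_range]
  refine sum_congr rfl fun k _ => ?_
  rw [← sum_filter, pCount, ← nsmul_eq_mul, ← sum_const]
  refine sum_congr rfl fun S hS => ?_
  rw [(mem_powersetCard.1 (mem_filter.1 hS).1).2]

theorem legalSum_block (b : ℕ) (y : ℝ) (n r : ℕ) (hr : r + 1 ≤ b) :
    legalSum (fun m => max 1 (m % b)) y (b * n + (r + 1)) =
      (1 + r * y) * legalSum (fun m => max 1 (m % b)) y (b * n)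
        + y * legalSum (fun m => max 1 (m % b)) y (b * n - 1) := by
  induction r with
  | zero =>
    rw [zero_add, legalSum_succ]
    simp
  | succ r ih =>
    have hmod : max 1 ((b * n + (r + 1)) % b) = r + 1 := by
      rw [Nat.mul_add_mod, Nat.mod_eq_of_lt (by omega)]
      omega
    rw [← add_assoc, legalSum_succ, ih (by omega), hmod, Nat.add_sub_cancel]
    push_cast
    ring

theorem legalSum_rec (b : ℕ) (hb : 3 ≤ b) (y : ℝ) (n : ℕ) :
    legalSum (fun m => max 1 (m % b)) y (b * (n + 2)) =
      (b * y + 1) * legalSum (fun m => max 1 (m % b)) y (b * (n + 1))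
        - y ^ 2 * legalSum (fun m => max 1 (m % b)) y (b * n) := by
  obtain ⟨c, rfl⟩ : ∃ c, b = c + 2 := ⟨b - 2, by omega⟩
  have h₁ := legalSum_block (c + 2) y (n + 1) (c + 1) le_rfl
  have h₂ := legalSum_block (c + 2) y n (c + 1) le_rfl
  have h₃ := legalSum_block (c + 2) y n c (by omega)
  rw [show (c + 2) * n + (c + 1) = (c + 2) * (n + 1) - 1 by rw [mul_add]; omega] at h₃
  rw [show (c + 2) * n + (c + 1 + 1) = (c + 2) * (n + 1) by ring] at h₂
  rw [show (c + 2) * (n + 1) + (c + 1 + 1) = (c + 2) * (n + 2) by ring] at h₁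
  push_cast at *
  linear_combination h₁ + y * h₃ - y * h₂

theorem legalSum_one_block (b : ℕ) (hb : 3 ≤ b) (y : ℝ) :
    legalSum (fun m => max 1 (m % b)) y (b * 1) = b * y + 1 := by
  obtain ⟨c, rfl⟩ : ∃ c, b = c + 1 := ⟨b - 1, by omega⟩
  have h := legalSum_block (c + 1) y 0 c le_rfl
  simp only [mul_zero, zero_add, Nat.zero_sub, legalSum_zero] at h
  rw [mul_one, h]
  push_cast
  ring

theorem stmt11 (b : ℕ) (hb : 3 ≤ b) (y : ℝ) (hy : 0 < y) (n : ℕ)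
    (D : ℝ) (hD : D = ((b : ℝ) ^ 2 - 4) * y ^ 2 + 2 * b * y + 1) :
    0 < D ∧
    ∑ k ∈ range (b * n + 1), (pCount b n k : ℝ) * y ^ k =
      (((b : ℝ) * y + 1 + Real.sqrt D) ^ (n + 1)
        - ((b : ℝ) * y + 1 - Real.sqrt D) ^ (n + 1)) / (2 ^ (n + 1) * Real.sqrt D) := by
  have hb' : (3 : ℝ) ≤ b := by exact_mod_cast hb
  have hpos : 0 < D := by
    have : 0 < (b : ℝ) ^ 2 - 4 := by nlinarith
    rw [hD]
    positivity
  refine ⟨hpos, ?_⟩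
  rw [sum_pCount_mul_pow]
  have hs : Real.sqrt D ≠ 0 := (Real.sqrt_pos.2 hpos).ne'
  have hsq : Real.sqrt D ^ 2 = ((b : ℝ) ^ 2 - 4) * y ^ 2 + 2 * b * y + 1 := by
    rw [Real.sq_sqrt hpos.le, hD]
  generalize Real.sqrt D = s at hs hsq ⊢
  rw [eq_div_iff (by positivity)]
  induction n using Nat.twoStepInduction with
  | zero =>
    rw [mul_zero, legalSum_zero]
    ring
  | one =>
    rw [legalSum_one_block b hb]
    ring
  | more n ih₀ ih₁ =>
    rw [legalSum_rec b hb]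
    linear_combination 2 * ((b : ℝ) * y + 1) * ih₁ - 4 * y ^ 2 * ih₀
      - ((b * y + 1 + s) ^ (n + 1) - (b * y + 1 - s) ^ (n + 1)) * hsq
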